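/- arXiv:1502.07769 — 2 statements merged into one kernel-verified Lean document; each statement's English description precedes it below -/
import Mathlib

section
/- Let A and B be countable relational structures such that Pol(B) has a strong gate covering, and let h : Pol(A) → Pol(B) be a continuous clone isomorphism. Then h is a homeomorphism. -/
set_option autoImplicit false

/-! ## Relational signatures and structures -/

structure RelSig where
  symbols : Type
  arity : symbols → ℕ

structure RelStr (σ : RelSig) where
  carrier : Type
  rel : ∀ s : σ.symbols, Set (Fin (σ.arity s) → carrier)

namespace RelStr

variable {σ : RelSig}

/-- Homomorphisms of relational structures. -/
def IsHom (A B : RelStr σ) (h : A.carrier → B.carrier) : Prop :=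
  ∀ (s : σ.symbols) (t : Fin (σ.arity s) → A.carrier),
    t ∈ A.rel s → (fun j => h (t j)) ∈ B.rel s

/-- Embeddings of relational structures. -/
def IsEmb (A B : RelStr σ) (h : A.carrier → B.carrier) : Prop :=
  Function.Injective h ∧
    ∀ (s : σ.symbols) (t : Fin (σ.arity s) → A.carrier),
      t ∈ A.rel s ↔ (fun j => h (t j)) ∈ B.rel s

/-- Automorphisms: surjective self-embeddings. -/
def IsAut (A : RelStr σ) (h : A.carrier → A.carrier) : Prop :=
  Function.Surjective h ∧ IsEmb A A h

/-- The n-th direct power of a relational structure. -/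
def pow (A : RelStr σ) (n : ℕ) : RelStr σ where
  carrier := Fin n → A.carrier
  rel s := {t | ∀ i : Fin n, (fun j => t j i) ∈ A.rel s}

/-- The direct product of two relational structures. -/
def prod (A B : RelStr σ) : RelStr σ where
  carrier := A.carrier × B.carrier
  rel s := {t | (fun j => (t j).1) ∈ A.rel s ∧ (fun j => (t j).2) ∈ B.rel s}

/-- `A.inAge B` : `B` belongs to the age of `A`, i.e. `B` is finite and embeddable into `A`. -/
def inAge (A B : RelStr σ) : Prop :=
  Finite B.carrier ∧ ∃ h : B.carrier → A.carrier, IsEmb B A h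

/-- `Younger A U` : the age of `A` is contained in the age of `U`. -/
def Younger (A U : RelStr σ) : Prop :=
  ∀ B : RelStr σ, inAge A B → inAge U B

/-- Homogeneity: any two embeddings of a member of the age differ by an automorphism. -/
def IsHomogeneous (U : RelStr σ) : Prop :=
  ∀ B : RelStr σ, inAge U B →
    ∀ ι₁ ι₂ : B.carrier → U.carrier, IsEmb B U ι₁ → IsEmb B U ι₂ →
      ∃ h : U.carrier → U.carrier, IsAut U h ∧ ∀ b, h (ι₁ b) = ι₂ b

/-- ω-categoricity of a countable structure, rendered via the
Engeler–Ryll-Nardzewski–Svenonius theorem: the automorphism group is oligomorphic,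
i.e. has finitely many orbits on `n`-tuples for every `n`. -/
def IsOligomorphic (U : RelStr σ) : Prop :=
  ∀ n : ℕ, ∃ (k : ℕ) (reps : Fin k → (Fin n → U.carrier)),
    ∀ t : Fin n → U.carrier, ∃ (j : Fin k) (h : U.carrier → U.carrier),
      IsAut U h ∧ ∀ i, h (reps j i) = t i

/-- The automorphism group acts transitively on the carrier. -/
def AutTransitive (U : RelStr σ) : Prop :=
  ∀ x y : U.carrier, ∃ h : U.carrier → U.carrier, IsAut U h ∧ h x = y

/-- `D` (with embeddings `g₁, g₂`) is the amalgamated free sum of `B₁` and `B₂`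
over `A` (with embeddings `f₁, f₂`): the carriers are glued exactly along `A`, and
every relation of `D` comes from `B₁` or from `B₂`. -/
def IsFreeAmalgam (A B₁ B₂ D : RelStr σ)
    (f₁ : A.carrier → B₁.carrier) (f₂ : A.carrier → B₂.carrier)
    (g₁ : B₁.carrier → D.carrier) (g₂ : B₂.carrier → D.carrier) : Prop :=
  IsEmb B₁ D g₁ ∧ IsEmb B₂ D g₂ ∧ (∀ a, g₁ (f₁ a) = g₂ (f₂ a)) ∧
    (∀ d : D.carrier, (∃ b, g₁ b = d) ∨ (∃ b, g₂ b = d)) ∧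
    (∀ b₁ b₂, g₁ b₁ = g₂ b₂ → ∃ a, f₁ a = b₁ ∧ f₂ a = b₂) ∧
    ∀ (s : σ.symbols) (t : Fin (σ.arity s) → D.carrier), t ∈ D.rel s →
      (∃ t' ∈ B₁.rel s, ∀ j, g₁ (t' j) = t j) ∨ (∃ t' ∈ B₂.rel s, ∀ j, g₂ (t' j) = t j)

/-- The age of `U` has the free amalgamation property. -/
def AgeFAP (U : RelStr σ) : Prop :=
  ∀ A B₁ B₂ : RelStr σ, inAge U A → inAge U B₁ → inAge U B₂ →
    ∀ (f₁ : A.carrier → B₁.carrier) (f₂ : A.carrier → B₂.carrier),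
      IsEmb A B₁ f₁ → IsEmb A B₂ f₂ →
      ∃ (D : RelStr σ) (g₁ : B₁.carrier → D.carrier) (g₂ : B₂.carrier → D.carrier),
        inAge U D ∧ IsFreeAmalgam A B₁ B₂ D f₁ f₂ g₁ g₂

/-- The age of `U` is closed with respect to finite products. -/
def AgeClosedUnderProducts (U : RelStr σ) : Prop :=
  ∀ A B : RelStr σ, inAge U A → inAge U B → inAge U (A.prod B)

/-- The age of `U` has the homo-amalgamation property (HAP). -/
def AgeHAP (U : RelStr σ) : Prop :=
  ∀ A B C : RelStr σ, inAge U A → inAge U B → inAge U C →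
    ∀ (f : A.carrier → B.carrier) (g : A.carrier → C.carrier),
      IsHom A B f → IsEmb A C g →
      ∃ (D : RelStr σ) (f' : C.carrier → D.carrier) (g' : B.carrier → D.carrier),
        inAge U D ∧ IsHom C D f' ∧ IsEmb B D g' ∧ ∀ a, f' (g a) = g' (f a)

end RelStr

open RelStr

/-! ## Primitive positive formulas -/

/-- Primitive positive formulas with `n` free variables. -/
inductive PP (σ : RelSig) : ℕ → Type
  | eq : ∀ {n : ℕ}, Fin n → Fin n → PP σ n
  | rel : ∀ {n : ℕ} (s : σ.symbols), (Fin (σ.arity s) → Fin n) → PP σ n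
  | and : ∀ {n : ℕ}, PP σ n → PP σ n → PP σ n
  | ex : ∀ {n : ℕ}, PP σ (n + 1) → PP σ n

/-- Satisfaction of a primitive positive formula. -/
def PP.Sat {σ : RelSig} (U : RelStr σ) : ∀ {n : ℕ}, PP σ n → (Fin n → U.carrier) → Prop
  | _, .eq i j, t => t i = t j
  | _, .rel s v, t => (fun k => t (v k)) ∈ U.rel s
  | _, .and φ ψ, t => PP.Sat U φ t ∧ PP.Sat U ψ t
  | _, .ex φ, t => ∃ a : U.carrier, PP.Sat U φ (Fin.snoc t a)

/-- Quantifier-free primitive positive formulas. -/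
def PP.QFree {σ : RelSig} : ∀ {n : ℕ}, PP σ n → Prop
  | _, .eq _ _ => True
  | _, .rel _ _ => True
  | _, .and φ ψ => PP.QFree φ ∧ PP.QFree ψ
  | _, .ex _ => False

/-- `U` has quantifier elimination for primitive positive formulas. -/
def HasPPQE {σ : RelSig} (U : RelStr σ) : Prop :=
  ∀ (n : ℕ) (φ : PP σ n), ∃ ψ : PP σ n, PP.QFree ψ ∧
    ∀ t : Fin n → U.carrier, PP.Sat U φ t ↔ PP.Sat U ψ t

/-! ## Polymorphisms -/

/-- An `n`-ary polymorphism of `U`: a homomorphism `Uⁿ → U`. -/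
def IsPolymorphism {σ : RelSig} (U : RelStr σ) (n : ℕ)
    (u : (Fin n → U.carrier) → U.carrier) : Prop :=
  IsHom (U.pow n) U u

/-- Universal `n`-ary polymorphism. -/
def IsUniversalPolymorphism {σ : RelSig} (U : RelStr σ) (n : ℕ)
    (u : (Fin n → U.carrier) → U.carrier) : Prop :=
  IsPolymorphism U n u ∧
    ∀ A : RelStr σ, Countable A.carrier → Younger A U →
      ∀ f : (Fin n → A.carrier) → U.carrier, IsHom (A.pow n) U f →
        ∃ ι : A.carrier → U.carrier, IsEmb A U ι ∧
          ∀ t : Fin n → A.carrier, f t = u (fun i => ι (t i))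

/-- Homogeneous `n`-ary polymorphism. -/
def IsHomogeneousPolymorphism {σ : RelSig} (U : RelStr σ) (n : ℕ)
    (u : (Fin n → U.carrier) → U.carrier) : Prop :=
  IsPolymorphism U n u ∧
    ∀ A : RelStr σ, inAge U A →
      ∀ f : (Fin n → A.carrier) → U.carrier, IsHom (A.pow n) U f →
        ∀ ι₁ ι₂ : A.carrier → U.carrier, IsEmb A U ι₁ → IsEmb A U ι₂ →
          (∀ t : Fin n → A.carrier, u (fun i => ι₁ (t i)) = f t) →
          (∀ t : Fin n → A.carrier, u (fun i => ι₂ (t i)) = f t) →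
          ∃ h : U.carrier → U.carrier, IsAut U h ∧ (∀ a, h (ι₁ a) = ι₂ a) ∧
            ∀ t : Fin n → U.carrier, u (fun i => h (t i)) = u t

/-! ## Clones of finitary operations

Operations of arity `n + 1` are indexed by `n : ℕ`, so that all arities are `≥ 1`. -/

structure Clone (U : Type) where
  ops : ∀ n : ℕ, Set ((Fin (n + 1) → U) → U)
  proj_mem : ∀ (n : ℕ) (i : Fin (n + 1)), (fun x => x i) ∈ ops n
  comp_mem : ∀ {n m : ℕ} (f : (Fin (n + 1) → U) → U) (g : Fin (n + 1) → (Fin (m + 1) → U) → U),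
      f ∈ ops n → (∀ i, g i ∈ ops m) → (fun x => f fun i => g i x) ∈ ops m

/-- The underlying set of a clone: the disjoint sum of its arity fibers. -/
abbrev Clone.Elem {U : Type} (C : Clone U) : Type := Σ n : ℕ, ↥(C.ops n)

/-- The polymorphism clone of a relational structure. -/
def polClone {σ : RelSig} (U : RelStr σ) : Clone U.carrier where
  ops n := {f | IsPolymorphism U (n + 1) f}
  proj_mem n i := fun s t ht => ht i
  comp_mem f g hf hg := fun s t ht => hf s (fun j i => g i (t j)) (fun i => hg i s t ht)

/-- The topology of pointwise convergence (the carrier being discrete) on the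
space of `n+1`-ary operations on `U`. -/
def fnTop (U : Type) (n : ℕ) : TopologicalSpace ((Fin (n + 1) → U) → U) :=
  letI : TopologicalSpace U := ⊥
  inferInstance

/-- The topology of pointwise convergence on an arity fiber of a clone. -/
def opsTop {U : Type} (C : Clone U) (n : ℕ) : TopologicalSpace ↥(C.ops n) :=
  letI : TopologicalSpace U := ⊥
  inferInstance

/-- The canonical topology on a clone: the sum over all arities of the topologies
of pointwise convergence. -/
def cloneTop {U : Type} (C : Clone U) : TopologicalSpace C.Elem :=
  letI : TopologicalSpace U := ⊥
  inferInstance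

/-- Clone homomorphisms: arity preserving maps preserving projections and composition. -/
structure CloneHom {U V : Type} (C : Clone U) (D : Clone V) where
  app : ∀ n : ℕ, ↥(C.ops n) → ↥(D.ops n)
  map_proj : ∀ (n : ℕ) (i : Fin (n + 1)),
    (app n ⟨fun x => x i, C.proj_mem n i⟩).val = fun x => x i
  map_comp : ∀ (n m : ℕ) (f : ↥(C.ops n)) (g : Fin (n + 1) → ↥(C.ops m)),
    (app m ⟨fun x => f.val fun i => (g i).val x,
        C.comp_mem f.val (fun i => (g i).val) f.property (fun i => (g i).property)⟩).val
      = fun x => (app n f).val fun i => (app m (g i)).val x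

/-- The action of a clone homomorphism on the underlying sets. -/
def CloneHom.elemMap {U V : Type} {C : Clone U} {D : Clone V} (h : CloneHom C D) :
    C.Elem → D.Elem :=
  fun p => ⟨p.1, h.app p.1 p.2⟩

/-- Application of a unary operation (in the `Fin 1` encoding) to a point. -/
def ap1 {U : Type} (φ : (Fin 1 → U) → U) (u : U) : U := φ (fun _ => u)

/-- The group of units of the unary part of a clone. -/
def cloneUnits {U : Type} (C : Clone U) : Set ((Fin 1 → U) → U) :=
  {φ | φ ∈ C.ops 0 ∧ ∃ ψ ∈ C.ops 0, (∀ u, ap1 φ (ap1 ψ u) = u) ∧ ∀ u, ap1 ψ (ap1 φ u) = u}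

/-- The closure of the group of units inside the unary part of a clone. -/
def unitClosure {U : Type} (C : Clone U) : Set ((Fin 1 → U) → U) :=
  C.ops 0 ∩ @closure _ (fnTop U 0) (cloneUnits C)

/-- Cauchy sequences of functions with respect to the complete ultrametric of
pointwise convergence (discrete codomain): at every argument, the sequence of
values is eventually constant. -/
def PtwCauchy {α U : Type} (g : ℕ → α → U) : Prop :=
  ∀ x : α, ∃ N : ℕ, ∀ m, N ≤ m → ∀ m', N ≤ m' → g m x = g m' x

/-- Pointwise convergence of a sequence of functions (discrete codomain). -/
def PtwConv {α β : Type} (g : ℕ → α → β) (f : α → β) : Prop :=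
  ∀ x : α, ∃ N : ℕ, ∀ j, N ≤ j → g j x = f x

/-- A strong gate covering of a clone. -/
def StrongGateCovering {U : Type} (C : Clone U) : Prop :=
  ∃ (𝒰 : Set (Set C.Elem)) (F : ∀ V ∈ 𝒰, C.Elem),
    (∀ V ∈ 𝒰, @IsOpen _ (cloneTop C) V) ∧
    (∀ p : C.Elem, ∃ V ∈ 𝒰, p ∈ V) ∧
    (∀ V (hV : V ∈ 𝒰), F V hV ∈ V) ∧
    ∀ V (hV : V ∈ 𝒰) (k : ℕ) (g : ℕ → ↥(C.ops k)),
      (∀ j : ℕ, (⟨k, g j⟩ : C.Elem) ∈ V) →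
      PtwCauchy (fun j => (g j).val) →
      ∃ fV : ↥(C.ops k), F V hV = ⟨k, fV⟩ ∧
        ∃ (κ : ℕ → (Fin 1 → U) → U) (ι : Fin (k + 1) → ℕ → (Fin 1 → U) → U),
          (∀ j, κ j ∈ unitClosure C) ∧ (∀ i j, ι i j ∈ unitClosure C) ∧
          PtwCauchy κ ∧ (∀ i, PtwCauchy (ι i)) ∧
          ∀ (j : ℕ) (x : Fin (k + 1) → U),
            (g j).val x = ap1 (κ j) (fV.val fun i => ap1 (ι i j) (x i))

/-- A closed (sub)clone of the clone of all operations. -/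
def IsClosedClone {U : Type} (C : Clone U) : Prop :=
  ∀ n : ℕ, @IsClosed _ (fnTop U n) (C.ops n)

/-! ## Posets as relational structures -/

/-- The signature with a single binary relation symbol. -/
def sigOrd : RelSig := ⟨Unit, fun _ => 2⟩

/-- A (reflexive) partial order viewed as a relational structure. -/
def ordStruc (P : Type) [PartialOrder P] : RelStr sigOrd where
  carrier := P
  rel _ := {t : Fin 2 → P | t 0 ≤ t 1}

/-! ## The amalgamation extension property AEPⁿ and the homo-amalgamation property HAPⁿ -/

/-- A class `𝒞` of relational structures has the AEPⁿ. -/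
def HasAEPn {σ : RelSig} (𝒞 : RelStr σ → Prop) (n : ℕ) : Prop :=
  ∀ A B₁ B₂ T : RelStr σ, 𝒞 A → 𝒞 B₁ → 𝒞 B₂ → 𝒞 T →
    ∀ (f₁ : A.carrier → B₁.carrier) (f₂ : A.carrier → B₂.carrier),
      RelStr.IsEmb A B₁ f₁ → RelStr.IsEmb A B₂ f₂ →
      ∀ (h₁ : (Fin n → B₁.carrier) → T.carrier) (h₂ : (Fin n → B₂.carrier) → T.carrier),
        RelStr.IsHom (B₁.pow n) T h₁ → RelStr.IsHom (B₂.pow n) T h₂ →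
        (∀ t : Fin n → A.carrier, h₁ (fun i => f₁ (t i)) = h₂ (fun i => f₂ (t i))) →
        ∃ (C T' : RelStr σ) (g₁ : B₁.carrier → C.carrier) (g₂ : B₂.carrier → C.carrier)
            (k : T.carrier → T'.carrier) (h : (Fin n → C.carrier) → T'.carrier),
          𝒞 C ∧ 𝒞 T' ∧ RelStr.IsEmb B₁ C g₁ ∧ RelStr.IsEmb B₂ C g₂ ∧
            (∀ a, g₁ (f₁ a) = g₂ (f₂ a)) ∧ RelStr.IsEmb T T' k ∧
            RelStr.IsHom (C.pow n) T' h ∧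
            (∀ t : Fin n → B₁.carrier, h (fun i => g₁ (t i)) = k (h₁ t)) ∧
            (∀ t : Fin n → B₂.carrier, h (fun i => g₂ (t i)) = k (h₂ t))

/-- A class `𝒞` of relational structures has the HAPⁿ. -/
def HasHAPn {σ : RelSig} (𝒞 : RelStr σ → Prop) (n : ℕ) : Prop :=
  ∀ A B T₁ : RelStr σ, 𝒞 A → 𝒞 B → 𝒞 T₁ →
    ∀ (g : A.carrier → B.carrier) (a : (Fin n → A.carrier) → T₁.carrier),
      RelStr.IsEmb A B g → RelStr.IsHom (A.pow n) T₁ a →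
      ∃ (T₂ : RelStr σ) (h : T₁.carrier → T₂.carrier) (b : (Fin n → B.carrier) → T₂.carrier),
        𝒞 T₂ ∧ RelStr.IsEmb T₁ T₂ h ∧ RelStr.IsHom (B.pow n) T₂ b ∧
          ∀ t : Fin n → A.carrier, b (fun i => g (t i)) = h (a t)
open Filter Topology MeasureTheory

/-! ## Open subgroups and pointwise convergence -/

/-- A Borel subgroup of countable index in a Baire topological group is open. -/
theorem Subgroup.isOpen_of_measurableSet_of_countable {G : Type*} [Group G] [TopologicalSpace G]
    [IsTopologicalGroup G] [BaireSpace G] [MeasurableSpace G] [BorelSpace G] (H : Subgroup G)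
    (hH : MeasurableSet (H : Set G)) [Countable (G ⧸ H)] : IsOpen (H : Set G) := by
  have hpre : ∀ (g : G) {s : Set G}, IsMeagre s → IsMeagre ((fun x => g * x) ⁻¹' s) := fun g s hs =>
    hs.preimage_of_isOpenMap (continuous_const_mul g) (isOpenMap_mul_left g)
  have hnm : ¬ IsMeagre (H : Set G) := by
    intro hm
    refine not_isMeagre_of_isOpen (isOpen_univ (X := G)) ⟨1, trivial⟩ ?_
    refine (isMeagre_iUnion fun q : G ⧸ H => hpre (q.out)⁻¹ hm).mono fun x _ => ?_
    refine Set.mem_iUnion.2 ⟨(x : G ⧸ H), ?_⟩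
    exact QuotientGroup.eq.1 (QuotientGroup.out_eq' (x : G ⧸ H))
  obtain ⟨O, hO, hHO⟩ := hH.residualEq_isOpen
  have hne : O.Nonempty := by
    by_contra hemp
    rw [Set.not_nonempty_iff_eq_empty] at hemp
    refine hnm ?_
    filter_upwards [eventuallyEq_set.1 hHO] with x hx
    simpa [hemp] using hx
  obtain ⟨u, hu⟩ := hne
  refine H.isOpen_of_mem_nhds (g := 1) ?_
  have hnhds : {g : G | g * u ∈ O} ∈ 𝓝 (1 : G) :=
    (hO.preimage (continuous_mul_const u)).mem_nhds (by simpa using hu)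
  filter_upwards [hnhds] with g hg
  have hmeagre : IsMeagre {x | ¬ (x ∈ (H : Set G) ↔ x ∈ O)} := by
    filter_upwards [eventuallyEq_set.1 hHO] with x hx
    simpa using hx
  have hopen : IsOpen (O ∩ (fun x => g⁻¹ * x) ⁻¹' O) :=
    hO.inter (hO.preimage (continuous_const_mul g⁻¹))
  have hnm' := not_isMeagre_of_isOpen hopen ⟨g * u, hg, by simpa using hu⟩
  have : ∃ x ∈ O ∩ (fun x => g⁻¹ * x) ⁻¹' O, x ∈ H ∧ g⁻¹ * x ∈ H := by
    by_contra! hcon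
    refine hnm' ((hmeagre.union (hpre g⁻¹ hmeagre)).mono fun x hx => ?_)
    by_cases hxH : x ∈ H
    · exact Or.inr fun hiff => hcon x hx hxH (hiff.2 hx.2)
    · exact Or.inl fun hiff => hxH (hiff.2 hx.1)
  obtain ⟨x, -, hx, hgx⟩ := this
  simpa using H.mul_mem hx (H.inv_mem hgx)

theorem PtwConv.ptwCauchy {α U : Type} {g : ℕ → α → U} {f : α → U} (h : PtwConv g f) : PtwCauchy g := by
  intro x
  obtain ⟨N, hN⟩ := h x
  exact ⟨N, fun m hm m' hm' => (hN m hm).trans (hN m' hm').symm⟩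

theorem PtwCauchy.exists_ptwConv {α U : Type} {g : ℕ → α → U} (h : PtwCauchy g) : ∃ f, PtwConv g f := by
  choose N hN using h
  exact ⟨fun x => g (N x) x, fun x => ⟨N x, fun j hj => hN x j hj _ le_rfl⟩⟩

/-- A neighbourhood in the topology of pointwise convergence constrains finitely many values. -/
theorem exists_finset_of_mem_nhds {α U X : Type*} [TopologicalSpace U] {φ : X → α → U}
    {x : X} {s : Set X} (hs : s ∈ comap φ (𝓝 (φ x))) :
    ∃ T : Finset α, ∀ y, (∀ t ∈ T, φ y t = φ x t) → y ∈ s := by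
  obtain ⟨t, ht, hts⟩ := hs
  rw [nhds_pi, Filter.mem_pi] at ht
  obtain ⟨I, hI, w, hw, hIw⟩ := ht
  refine ⟨hI.toFinset, fun y hy => hts (hIw fun i hi => ?_)⟩
  rw [hy i (hI.mem_toFinset.2 hi)]
  exact mem_of_mem_nhds (hw i)

theorem tendsto_atTop_iff_ptwConv {α U : Type} [TopologicalSpace U] [DiscreteTopology U] {g : ℕ → α → U} {f : α → U} :
    Tendsto g atTop (𝓝 f) ↔ PtwConv g f := by
  simp [tendsto_pi_nhds, nhds_discrete, PtwConv]

/-! ## The unary part of a clone -/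

namespace Clone

variable {U : Type}

/-- The unary part of a clone, as a type carrying its monoid structure. -/
abbrev Unary (C : Clone U) : Type := ↥(C.ops 0)

variable (C : Clone U)

instance : Monoid C.Unary where
  mul f g := ⟨fun x => f.val fun _ => g.val x,
    C.comp_mem f.val (fun _ => g.val) f.property fun _ => g.property⟩
  one := ⟨fun x => x 0, C.proj_mem 0 0⟩
  mul_assoc _ _ _ := rfl
  one_mul _ := rfl
  mul_one f := Subtype.ext <| funext fun x =>
    congrArg f.val (funext fun i => congrArg x (Subsingleton.elim (α := Fin 1) 0 i))

variable {C}

theorem exists_unit_of_mem_cloneUnits {φ : (Fin 1 → U) → U} (hφ : φ ∈ cloneUnits C) :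
    ∃ u : C.Unaryˣ, (u : C.Unary).val = φ := by
  obtain ⟨h₁, ψ, h₂, hφψ, hψφ⟩ := hφ
  have hx : ∀ x : Fin 1 → U, x = fun _ => x 0 := fun x =>
    funext fun i => congrArg x (Subsingleton.elim i 0)
  refine ⟨⟨⟨φ, h₁⟩, ⟨ψ, h₂⟩, Subtype.ext (funext fun x => ?_), Subtype.ext (funext fun x => ?_)⟩,
    rfl⟩
  · rw [hx x]; exact hφψ _
  · rw [hx x]; exact hψφ _

theorem Unary.inv_mul_val_eq_iff (u v : C.Unaryˣ) (a : Fin 1 → U) :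
    ((u⁻¹ * v : C.Unaryˣ) : C.Unary).val a = a 0 ↔ (u : C.Unary).val a = (v : C.Unary).val a := by
  have hx : ∀ x : Fin 1 → U, (fun _ => x 0) = x := fun x =>
    funext fun i => congrArg x (Subsingleton.elim 0 i)
  have hinv : ∀ (w : C.Unaryˣ) (x : Fin 1 → U),
      (w : C.Unary).val (fun _ => ((w⁻¹ : C.Unaryˣ) : C.Unary).val x) = x 0 := fun w x =>
    congrArg (fun f : C.Unary => f.val x) (Units.mul_inv w)
  change ((u⁻¹ : C.Unaryˣ) : C.Unary).val (fun _ => (v : C.Unary).val a) = a 0 ↔ _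
  constructor
  · intro h
    have h' := hinv u fun _ => (v : C.Unary).val a
    rwa [h, hx] at h'
  · intro h
    rw [← h]
    simpa using hinv u⁻¹ a

variable [TopologicalSpace U]

theorem Unary.continuous_val : Continuous fun f : C.Unary => f.val := continuous_subtype_val

theorem nhds_one_unary_units : 𝓝 (1 : C.Unaryˣ) =
    comap (fun u : C.Unaryˣ => (u : C.Unary).val) (𝓝 ((1 : C.Unaryˣ) : C.Unary).val) ⊓
    comap (fun u : C.Unaryˣ => ((u⁻¹ : C.Unaryˣ) : C.Unary).val)
      (𝓝 (((1 : C.Unaryˣ)⁻¹ : C.Unaryˣ) : C.Unary).val) := by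
  have hv : IsInducing fun f : C.Unary => f.val := IsInducing.subtypeVal
  have h₁ := nhds_inf (t₁ := .induced (Units.val : C.Unaryˣ → C.Unary) inferInstance)
    (t₂ := .induced (fun u : C.Unaryˣ => ((u⁻¹ : C.Unaryˣ) : C.Unary)) inferInstance) (a := 1)
  rw [nhds_induced Units.val, nhds_induced (fun u : C.Unaryˣ => ((u⁻¹ : C.Unaryˣ) : C.Unary)),
    hv.nhds_eq_comap, hv.nhds_eq_comap, comap_comap, comap_comap, ← Units.topology_eq_inf] at h₁
  exact h₁

variable [DiscreteTopology U]

instance : ContinuousMul C.Unary where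
  continuous_mul := by
    refine Continuous.subtype_mk (continuous_pi fun x => ?_) _
    have hev : Continuous fun p : ((Fin 1 → U) → U) × U => p.1 fun _ => p.2 :=
      continuous_prod_of_discrete_right.2 fun b => continuous_apply (fun _ : Fin 1 => b)
    exact hev.comp ((Unary.continuous_val.comp continuous_fst).prodMk
      ((continuous_apply x).comp (Unary.continuous_val.comp continuous_snd)))

theorem polishSpace_unary_units [Countable U] (hC : IsClosed (C.ops 0)) :
    PolishSpace C.Unaryˣ := by
  have : PolishSpace U := {}
  have : PolishSpace C.Unary := hC.polishSpace
  have : PolishSpace C.Unaryᵐᵒᵖ :=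
    MulOpposite.opHomeomorph.symm.isClosedEmbedding.polishSpace
  exact Units.isClosedEmbedding_embedProduct.polishSpace

end Clone

theorem isClosed_polClone_ops {σ : RelSig} (A : RelStr σ) [TopologicalSpace A.carrier]
    [DiscreteTopology A.carrier] (n : ℕ) : IsClosed ((polClone A).ops n) := by
  have heq : (polClone A).ops n = ⋂ (s) (t) (_ : t ∈ (A.pow (n + 1)).rel s),
      (fun (f : (Fin (n + 1) → A.carrier) → A.carrier) (j : Fin (σ.arity s)) => f (t j)) ⁻¹'
        A.rel s := by
    ext f
    simp only [Set.mem_iInter]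
    rfl
  rw [heq]
  refine isClosed_iInter fun s => isClosed_iInter fun t => isClosed_iInter fun _ => ?_
  exact (isClosed_discrete (A.rel s)).preimage (continuous_pi fun j => continuous_apply (t j))

/-! ## Clone isomorphisms -/

namespace CloneHom

variable {U V : Type} {C : Clone U} {D : Clone V} (h : CloneHom C D)
  (hbij : ∀ n, Function.Bijective (h.app n))

/-- The monoid isomorphism induced by a clone isomorphism on unary parts. -/
noncomputable def unaryEquiv : C.Unary ≃* D.Unary where
  toEquiv := Equiv.ofBijective (h.app 0) (hbij 0)
  map_mul' f g := Subtype.ext (h.map_comp 0 0 f fun _ => g)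

variable [TopologicalSpace U] [DiscreteTopology U] [TopologicalSpace V] [DiscreteTopology V]


/-- If the images of a Cauchy sequence under a continuous injective clone homomorphism converge,
then the sequence converges to a preimage of the limit. -/
theorem exists_tendsto_of_ptwCauchy {k : ℕ} (hC : IsClosed (C.ops k))
    (hcont : Continuous (h.app k)) {w : ℕ → ↥(C.ops k)} (hw : PtwCauchy fun j => (w j).val)
    {g : ↥(D.ops k)} (hg : Tendsto (fun j => h.app k (w j)) atTop (𝓝 g)) :
    ∃ f, h.app k f = g ∧ Tendsto w atTop (𝓝 f) := by
  obtain ⟨f, hf⟩ := hw.exists_ptwConv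
  have hf' := tendsto_atTop_iff_ptwConv.2 hf
  have hfC : f ∈ C.ops k := hC.mem_of_tendsto hf' (Eventually.of_forall fun j => (w j).property)
  have hwf : Tendsto w atTop (𝓝 ⟨f, hfC⟩) := tendsto_subtype_rng.2 hf'
  exact ⟨⟨f, hfC⟩, tendsto_nhds_unique ((hcont.tendsto _).comp hwf) hg, hwf⟩

/-- On units, every value of the inverse of a continuous clone isomorphism is controlled by
finitely many values of its argument. -/
theorem exists_finset_units [Countable U] [Countable V] (hC : IsClosed (C.ops 0))
    (hD : IsClosed (D.ops 0)) (hcont : Continuous (h.app 0)) (a : Fin 1 → U) :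
    ∃ T : Finset (Fin 1 → V), ∀ u v : D.Unaryˣ,
      (∀ t ∈ T, (u : D.Unary).val t = (v : D.Unary).val t) →
      ((h.unaryEquiv hbij).symm u).val a = ((h.unaryEquiv hbij).symm v).val a := by
  have := Clone.polishSpace_unary_units hC
  have := Clone.polishSpace_unary_units hD
  borelize C.Unaryˣ D.Unaryˣ
  let e := Units.mapEquiv (h.unaryEquiv hbij)
  have hecont : Continuous e :=
    Continuous.units_map (h.unaryEquiv hbij : C.Unary →* D.Unary) hcont
  have inv_iff (u : C.Unaryˣ) : ((u⁻¹ : C.Unaryˣ) : C.Unary).val a = a 0 ↔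
      (u : C.Unary).val a = a 0 := by
    have := Clone.Unary.inv_mul_val_eq_iff u 1 a
    rwa [mul_one] at this
  let S : Subgroup C.Unaryˣ :=
    { carrier := {u | (u : C.Unary).val a = a 0}
      mul_mem' := fun {u v} hu hv => by
        have := (Clone.Unary.inv_mul_val_eq_iff u⁻¹ v a).2
        rw [inv_inv] at this
        exact this (((inv_iff u).2 hu).trans (Eq.symm hv))
      one_mem' := rfl
      inv_mem' := fun {u} hu => (inv_iff u).2 hu }
  have hval : Continuous fun u : C.Unaryˣ => (u : C.Unary).val a :=
    (continuous_apply a).comp (Clone.Unary.continuous_val.comp Units.continuous_val)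
  have hSm : MeasurableSet (S : Set C.Unaryˣ) :=
    ((isClosed_discrete {a 0}).preimage hval).measurableSet
  let H : Subgroup D.Unaryˣ := S.map (e : C.Unaryˣ →* D.Unaryˣ)
  have hHm : MeasurableSet (H : Set D.Unaryˣ) :=
    hSm.image_of_continuousOn_injOn hecont.continuousOn e.injective.injOn
  have hmem : ∀ u v : D.Unaryˣ, u⁻¹ * v ∈ H ↔
      (e.symm u : C.Unary).val a = (e.symm v : C.Unary).val a := by
    intro u v
    have := Clone.Unary.inv_mul_val_eq_iff (e.symm u) (e.symm v) a
    rw [← map_inv, ← map_mul] at this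
    exact Subgroup.mem_map_equiv.trans this
  have : Countable (D.Unaryˣ ⧸ H) := by
    refine Function.Injective.countable
      (f := fun q : D.Unaryˣ ⧸ H => ((e.symm q.out : C.Unaryˣ) : C.Unary).val a) fun p q hpq => ?_
    rw [← QuotientGroup.out_eq' p, ← QuotientGroup.out_eq' q]
    exact QuotientGroup.eq.2 ((hmem _ _).2 hpq)
  have hopen := H.isOpen_of_measurableSet_of_countable hHm
  have hnhds := hopen.mem_nhds H.one_mem
  rw [Clone.nhds_one_unary_units, Filter.mem_inf_iff] at hnhds
  obtain ⟨s₁, hs₁, s₂, hs₂, hs⟩ := hnhds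
  obtain ⟨T₁, hT₁⟩ := exists_finset_of_mem_nhds hs₁
  obtain ⟨T₂, hT₂⟩ := exists_finset_of_mem_nhds hs₂
  classical
  refine ⟨T₁ ∪ T₂, fun u v huv => (hmem u v).1 ?_⟩
  change u⁻¹ * v ∈ (H : Set D.Unaryˣ)
  rw [hs]
  refine ⟨hT₁ _ fun t ht => ?_, hT₂ _ fun t ht => ?_⟩
  · exact (Clone.Unary.inv_mul_val_eq_iff u v t).2 (huv t (Finset.mem_union_left _ ht))
  · rw [mul_inv_rev, inv_inv]
    exact (Clone.Unary.inv_mul_val_eq_iff v u t).2 (huv t (Finset.mem_union_right _ ht)).symm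

/-- On preimages of the closure of the group of units, every value is controlled by finitely many
values of the image. -/
theorem exists_finset_closure_cloneUnits
    (hbij : ∀ n, Function.Bijective (h.app n)) [Countable U] [Countable V] (hC : IsClosed (C.ops 0))
    (hD : IsClosed (D.ops 0)) (hcont : Continuous (h.app 0)) (a : Fin 1 → U) :
    ∃ T : Finset (Fin 1 → V), ∀ f f' : ↥(C.ops 0),
      (h.app 0 f).val ∈ closure (cloneUnits D) → (h.app 0 f').val ∈ closure (cloneUnits D) →
      (∀ t ∈ T, (h.app 0 f).val t = (h.app 0 f').val t) → f.val a = f'.val a := by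
  have approx : ∀ (T : Finset (Fin 1 → V)) (f : ↥(C.ops 0)),
      (h.app 0 f).val ∈ closure (cloneUnits D) → ∃ u : D.Unaryˣ,
        (∀ t ∈ T, (u : D.Unary).val t = (h.app 0 f).val t) ∧
        ((h.unaryEquiv hbij).symm u).val a = f.val a := by
    intro T f hf
    obtain ⟨x, hx, hxf⟩ := mem_closure_iff_seq_limit.1 hf
    choose u hu using fun n => Clone.exists_unit_of_mem_cloneUnits (hx n)
    have happ : ∀ n, h.app 0 ((h.unaryEquiv hbij).symm (u n)) = (u n : D.Unary) := fun n =>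
      (h.unaryEquiv hbij).apply_symm_apply _
    have hev : ∀ T : Finset (Fin 1 → V), ∀ᶠ n in atTop, ∀ t ∈ T,
        (u n : D.Unary).val t = (h.app 0 f).val t := fun T => by
      refine (Filter.eventually_all_finset T).2 fun t _ => ?_
      simp only [hu]
      exact eventually_atTop.2 (tendsto_atTop_iff_ptwConv.1 hxf t)
    have hcauchy : PtwCauchy fun n => ((h.unaryEquiv hbij).symm (u n)).val := by
      intro b
      obtain ⟨T', hT'⟩ := exists_finset_units h hbij hC hD hcont b
      obtain ⟨N, hN⟩ := eventually_atTop.1 (hev T')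
      exact ⟨N, fun m hm m' hm' => hT' _ _ fun t ht => (hN m hm t ht).trans (hN m' hm' t ht).symm⟩
    have hlim : Tendsto (fun n => h.app 0 ((h.unaryEquiv hbij).symm (u n))) atTop
        (𝓝 (h.app 0 f)) := by
      refine tendsto_subtype_rng.2 ?_
      simpa only [happ, hu] using hxf
    obtain ⟨f', hf', hw⟩ := exists_tendsto_of_ptwCauchy h hC hcont hcauchy hlim
    obtain rfl := (hbij 0).1 hf'
    have hw' := eventually_atTop.2 (tendsto_atTop_iff_ptwConv.1 (tendsto_subtype_rng.1 hw) a)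
    obtain ⟨n, hn₁, hn₂⟩ := ((hev T).and hw').exists
    exact ⟨u n, hn₁, hn₂⟩
  obtain ⟨T, hT⟩ := exists_finset_units h hbij hC hD hcont a
  refine ⟨T, fun f f' hf hf' hff' => ?_⟩
  obtain ⟨u, hu, hua⟩ := approx T f hf
  obtain ⟨u', hu', hua'⟩ := approx T f' hf'
  rw [← hua, ← hua']
  exact hT u u' fun t ht => (hu t ht).trans ((hff' t ht).trans (hu' t ht).symm)

/-- A sequence whose image is a Cauchy sequence in the closure of the group of units is Cauchy. -/
theorem ptwCauchy_of_app_mem_closure_cloneUnits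
    (hbij : ∀ n, Function.Bijective (h.app n)) [Countable U] [Countable V]
    (hC : IsClosed (C.ops 0)) (hD : IsClosed (D.ops 0)) (hcont : Continuous (h.app 0))
    (f : ℕ → ↥(C.ops 0)) (hf : ∀ j, (h.app 0 (f j)).val ∈ closure (cloneUnits D))
    (hfc : PtwCauchy fun j => (h.app 0 (f j)).val) : PtwCauchy fun j => (f j).val := by
  intro a
  obtain ⟨T, hT⟩ := exists_finset_closure_cloneUnits h hbij hC hD hcont a
  choose N hN using hfc
  refine ⟨T.sup N, fun m hm m' hm' => hT _ _ (hf m) (hf m') fun t ht => ?_⟩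
  exact hN t m ((Finset.le_sup ht).trans hm) m' ((Finset.le_sup ht).trans hm')

end CloneHom

theorem PtwCauchy.gate {U : Type} {k : ℕ} {κ : ℕ → (Fin 1 → U) → U}
    {ι : Fin (k + 1) → ℕ → (Fin 1 → U) → U} (f : (Fin (k + 1) → U) → U) (hκ : PtwCauchy κ)
    (hι : ∀ i, PtwCauchy (ι i)) :
    PtwCauchy fun j (x : Fin (k + 1) → U) => ap1 (κ j) (f fun i => ap1 (ι i j) (x i)) := by
  intro x
  choose N hN using fun i => hι i fun _ => x i
  obtain ⟨M, hM⟩ := hκ fun _ => f fun i => ap1 (ι i (Finset.univ.sup N)) (x i)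
  have hval : ∀ m, Finset.univ.sup N ≤ m →
      (fun i => ap1 (ι i m) (x i)) = fun i => ap1 (ι i (Finset.univ.sup N)) (x i) := fun m hm =>
    funext fun i => hN i m ((Finset.le_sup (Finset.mem_univ i)).trans hm) _
      (Finset.le_sup (Finset.mem_univ i))
  refine ⟨max M (Finset.univ.sup N), fun m hm m' hm' => ?_⟩
  simp only [hval m ((le_max_right _ _).trans hm), hval m' ((le_max_right _ _).trans hm')]
  exact hM m ((le_max_left _ _).trans hm) m' ((le_max_left _ _).trans hm')

namespace Clone

variable {U : Type} (C : Clone U)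

/-- The operation `κ (f (ι₀ x₀, …, ιₖ xₖ))` obtained from `f` and unary operations `κ`, `ιᵢ`. -/
def gateComp {k : ℕ} (κ : ↥(C.ops 0)) (f : ↥(C.ops k)) (ι : Fin (k + 1) → ↥(C.ops 0)) :
    ↥(C.ops k) :=
  ⟨fun x => ap1 κ.val (f.val fun i => ap1 (ι i).val (x i)),
    C.comp_mem κ.val (fun _ x => f.val fun i => ap1 (ι i).val (x i)) κ.property fun _ =>
      C.comp_mem f.val (fun i x => ap1 (ι i).val (x i)) f.property fun i =>
        C.comp_mem (ι i).val (fun _ x => x i) (ι i).property fun _ => C.proj_mem k i⟩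

end Clone

namespace CloneHom

variable {U V : Type} {C : Clone U} {D : Clone V} (h : CloneHom C D)

theorem app_gateComp {k : ℕ} (κ : ↥(C.ops 0)) (f : ↥(C.ops k)) (ι : Fin (k + 1) → ↥(C.ops 0)) :
    h.app k (C.gateComp κ f ι) = D.gateComp (h.app 0 κ) (h.app k f) fun i => h.app 0 (ι i) := by
  let π : ∀ i : Fin (k + 1), ↥(C.ops k) := fun i => ⟨fun x => x i, C.proj_mem k i⟩
  let w : ∀ i : Fin (k + 1), ↥(C.ops k) := fun i => ⟨fun x => ap1 (ι i).val (x i),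
    C.comp_mem (ι i).val (fun _ => (π i).val) (ι i).property fun _ => (π i).property⟩
  have hw : ∀ i, (h.app k (w i)).val = fun x => ap1 (h.app 0 (ι i)).val (x i) := fun i => by
    refine (h.map_comp 0 k (ι i) fun _ => π i).trans ?_
    simp only [π, h.map_proj]
    rfl
  let v : ↥(C.ops k) := ⟨fun x => f.val fun i => (w i).val x,
    C.comp_mem f.val (fun i => (w i).val) f.property fun i => (w i).property⟩
  have hv : (h.app k v).val = fun x => (h.app k f).val fun i => ap1 (h.app 0 (ι i)).val (x i) := by
    refine (h.map_comp k k f w).trans ?_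
    simp only [hw]
  refine Subtype.ext ((h.map_comp 0 k κ fun _ => v).trans ?_)
  simp only [hv]
  rfl

/-- A continuous clone isomorphism onto a closed clone with a strong gate covering reflects
convergence of sequences. -/
theorem tendsto_of_tendsto_app (hbij : ∀ n, Function.Bijective (h.app n)) [Countable U]
    [Countable V] [TopologicalSpace U] [DiscreteTopology U] [TopologicalSpace V]
    [DiscreteTopology V] (hC : ∀ n, IsClosed (C.ops n)) (hD : IsClosed (D.ops 0))
    (hcont : ∀ n, Continuous (h.app n)) (hsgc : StrongGateCovering D) {k : ℕ}
    {f : ℕ → ↥(C.ops k)} {p : ↥(C.ops k)}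
    (hf : Tendsto (fun j => h.app k (f j)) atTop (𝓝 (h.app k p))) : Tendsto f atTop (𝓝 p) := by
  obtain ⟨𝒰, F, hopen, hcov, -, hgate⟩ := hsgc
  obtain ⟨W, hW, hpW⟩ := hcov ⟨k, h.app k p⟩
  have hWopen : IsOpen W := by
    have := hopen W hW
    rwa [cloneTop, ← DiscreteTopology.eq_bot (α := V)] at this
  have hev : ∀ᶠ j in atTop, (⟨k, h.app k (f j)⟩ : D.Elem) ∈ W :=
    ((continuous_sigmaMk (σ := fun n => ↥(D.ops n))).tendsto _).comp hf
      |>.eventually (hWopen.mem_nhds hpW)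
  obtain ⟨N, hN⟩ := eventually_atTop.1 hev
  have hfN := hf.comp (tendsto_add_atTop_nat N)
  obtain ⟨φ, -, κ, ι, hκ, hι, hκc, hιc, heq⟩ := hgate W hW k (fun j => h.app k (f (j + N)))
    (fun j => hN _ (Nat.le_add_left N j))
    (tendsto_atTop_iff_ptwConv.1 (tendsto_subtype_rng.1 hfN)).ptwCauchy
  have hcl : ∀ {u}, u ∈ unitClosure D → u ∈ closure (cloneUnits D) := fun hu => by
    have := hu.2
    rwa [fnTop, ← DiscreteTopology.eq_bot (α := V)] at this
  choose κ' hκ' using fun j => (hbij 0).2 ⟨κ j, (hκ j).1⟩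
  choose ι' hι' using fun i j => (hbij 0).2 ⟨ι i j, (hι i j).1⟩
  obtain ⟨φ', rfl⟩ := (hbij k).2 φ
  have hκ'c : PtwCauchy fun j => (κ' j).val :=
    ptwCauchy_of_app_mem_closure_cloneUnits h hbij (hC 0) hD (hcont 0) κ'
      (fun j => by rw [hκ']; exact hcl (hκ j)) (by simpa only [hκ'] using hκc)
  have hι'c : ∀ i, PtwCauchy fun j => (ι' i j).val := fun i =>
    ptwCauchy_of_app_mem_closure_cloneUnits h hbij (hC 0) hD (hcont 0) (ι' i)
      (fun j => by rw [hι']; exact hcl (hι i j)) (by simpa only [hι'] using hιc i)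
  have hfeq : ∀ j, f (j + N) = C.gateComp (κ' j) φ' fun i => ι' i j := fun j => by
    refine (hbij k).1 ?_
    rw [app_gateComp]
    simp only [hκ', hι']
    exact Subtype.ext (funext (heq j))
  have hfc : PtwCauchy fun j => (f (j + N)).val := by
    simp only [hfeq]
    exact PtwCauchy.gate φ'.val hκ'c hι'c
  obtain ⟨q, hq, hlim⟩ := exists_tendsto_of_ptwCauchy h (hC k) (hcont k) hfc hfN
  obtain rfl := (hbij k).1 hq
  exact (tendsto_add_atTop_iff_nat N).1 hlim

end CloneHom

/-- Let `A` and `B` be countable relational structures such that `Pol(B)`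
has a strong gate covering, and let `h : Pol(A) → Pol(B)` be a continuous clone
isomorphism.  Then `h` is a homeomorphism. -/
theorem stmt_2 {σ τ : RelSig} (A : RelStr σ) (B : RelStr τ)
    (hcA : Countable A.carrier) (hcB : Countable B.carrier)
    (hsgc : StrongGateCovering (polClone B))
    (h : CloneHom (polClone A) (polClone B))
    (hbij : ∀ n : ℕ, Function.Bijective (h.app n))
    (hcont : @Continuous _ _ (cloneTop (polClone A)) (cloneTop (polClone B)) h.elemMap) :
    @IsHomeomorph _ _ (cloneTop (polClone A)) (cloneTop (polClone B)) h.elemMap := by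
  let : TopologicalSpace A.carrier := ⊥
  let : TopologicalSpace B.carrier := ⊥
  have : DiscreteTopology A.carrier := ⟨rfl⟩
  have : DiscreteTopology B.carrier := ⟨rfl⟩
  have happ : ∀ n, Continuous (h.app n) := fun n => by
    refine (IsEmbedding.sigmaMk (σ := fun n => ↥((polClone B).ops n)) (i := n)).continuous_iff.2 ?_
    exact hcont.comp (continuous_sigmaMk (σ := fun n => ↥((polClone A).ops n)))
  let e := fun n => Equiv.ofBijective (h.app n) (hbij n)
  have hinv : ∀ n, Continuous (e n).symm := fun n => by
    refine continuous_iff_seqContinuous.2 fun g p hg => ?_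
    refine h.tendsto_of_tendsto_app hbij (isClosed_polClone_ops A) (isClosed_polClone_ops B 0)
      happ hsgc ?_
    have hright : ∀ q, h.app n ((e n).symm q) = q := (e n).apply_symm_apply
    simpa only [hright, Function.comp_apply] using hg
  refine isHomeomorph_iff_exists_inverse.2 ⟨hcont, fun q => ⟨q.1, (e q.1).symm q.2⟩, ?_, ?_, ?_⟩
  · rintro ⟨n, f⟩
    exact congrArg (Sigma.mk n) ((e n).symm_apply_apply f)
  · rintro ⟨n, f⟩
    exact congrArg (Sigma.mk n) ((e n).apply_symm_apply f)
  · exact continuous_sigma fun n =>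
      (continuous_sigmaMk (σ := fun n => ↥((polClone A).ops n))).comp (hinv n)
end

section
/- Let U be a countably infinite relational structure that has an n-ary universal homogeneous polymorphism u. Let (f_j)_{j<ω} be a sequence of n-ary polymorphisms of U converging (pointwise) to an n-ary polymorphism f of U. Then there exist a sequence (ι_j)_{j<ω} of self-embeddings of U and a self-embedding ι of U such that (1) for every j and every tuple, f_j(x₁,…,x_n) = u(ι_j(x₁),…,ι_j(x_n)); (2) (ι_j) converges pointwise to ι; and (3) f(x₁,…,x_n) = u(ι(x₁),…,ι(x_n)) for all tuples. -/
set_option autoImplicit false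

open RelStr

namespace RelStr

variable {σ : RelSig}

/-- The substructure induced on a set. -/
def induced (U : RelStr σ) (S : Set U.carrier) : RelStr σ where
  carrier := S
  rel s := {t | (fun j => (t j : U.carrier)) ∈ U.rel s}

lemma isEmb_val (U : RelStr σ) (S : Set U.carrier) :
    IsEmb (U.induced S) U (fun x => x.1) :=
  ⟨Subtype.val_injective, fun _ _ => Iff.rfl⟩

lemma IsEmb.comp {A B C : RelStr σ} {g : B.carrier → C.carrier} {f : A.carrier → B.carrier}
    (hg : IsEmb B C g) (hf : IsEmb A B f) : IsEmb A C (fun x => g (f x)) :=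
  ⟨hg.1.comp hf.1, fun s t => (hf.2 s t).trans (hg.2 s _)⟩

lemma younger_refl (U : RelStr σ) : Younger U U := fun _ h => h

/-- A factorization of a polymorphism through a homogeneous polymorphism can be adjusted to agree
on a finite set with a factorization of another polymorphism that coincides with it there. -/
lemma exists_factorization_eqOn {U : RelStr σ} {n : ℕ} {u : (Fin n → U.carrier) → U.carrier}
    (hu : IsHomogeneousPolymorphism U n u) {κ ι : U.carrier → U.carrier}
    (hκ : IsEmb U U κ) (hι : IsEmb U U ι) {S : Set U.carrier} (hS : S.Finite)
    (h : ∀ t : Fin n → U.carrier, (∀ i, t i ∈ S) →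
      u (fun i => κ (t i)) = u (fun i => ι (t i))) :
    ∃ κ' : U.carrier → U.carrier, IsEmb U U κ' ∧
      (∀ t : Fin n → U.carrier, u (fun i => κ' (t i)) = u (fun i => κ (t i))) ∧
      Set.EqOn κ' ι S := by
  obtain ⟨g, hg, hgι, hgu⟩ := hu.2 (U.induced S) ⟨hS.to_subtype, _, U.isEmb_val S⟩
    (fun t => u (fun i => ι (t i).1))
    (fun s t ht => hu.1 s (fun j i => ι (t j i).1)
      (fun i => (hι.2 s (fun j => (t j i).1)).1 (ht i)))
    (fun x => κ x.1) (fun x => ι x.1)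
    (hκ.comp (U.isEmb_val S)) (hι.comp (U.isEmb_val S))
    (fun t => h (fun i => (t i).1) (fun i => (t i).2)) (fun _ => rfl)
  exact ⟨fun x => g (κ x), hg.2.comp hκ, fun t => hgu _, fun x hx => hgι ⟨x, hx⟩⟩

end RelStr

/-- A pointwise convergent sequence eventually coincides with its limit on a finite set. -/
lemma PtwConv.eventually_eqOn {α β : Type} {g : ℕ → α → β} {f : α → β} (h : PtwConv g f)
    {S : Set α} (hS : S.Finite) : ∃ N : ℕ, ∀ j, N ≤ j → Set.EqOn (g j) f S := by
  have : ∀ᶠ j in Filter.atTop, ∀ x ∈ S, g j x = f x :=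
    (Filter.eventually_all_finite hS).2 fun x _ => Filter.eventually_atTop.2 (h x)
  exact Filter.eventually_atTop.1 this

/-- Let `U` be a countably infinite relational structure with an `n`-ary
universal homogeneous polymorphism `u`.  If a sequence `(f_j)` of `n`-ary polymorphisms
converges pointwise to an `n`-ary polymorphism `f`, then there are self-embeddings
`(ι_j)` and `ι` of `U` with `f_j = u ∘ ι_jⁿ` for all `j`, `ι_j → ι` pointwise, and
`f = u ∘ ιⁿ`. -/
theorem stmt_7 {σ : RelSig} (U : RelStr σ)
    (hc : Countable U.carrier) (hi : Infinite U.carrier)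
    (n : ℕ) (u : (Fin n → U.carrier) → U.carrier)
    (huniv : IsUniversalPolymorphism U n u)
    (hhomog : IsHomogeneousPolymorphism U n u)
    (fseq : ℕ → (Fin n → U.carrier) → U.carrier)
    (f : (Fin n → U.carrier) → U.carrier)
    (hfseq : ∀ j : ℕ, IsPolymorphism U n (fseq j))
    (hf : IsPolymorphism U n f)
    (hconv : PtwConv fseq f) :
    ∃ (ιseq : ℕ → U.carrier → U.carrier) (ι : U.carrier → U.carrier),
      (∀ j : ℕ, RelStr.IsEmb U U (ιseq j)) ∧ RelStr.IsEmb U U ι ∧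
      (∀ (j : ℕ) (t : Fin n → U.carrier), fseq j t = u (fun i => ιseq j (t i))) ∧
      PtwConv ιseq ι ∧
      (∀ t : Fin n → U.carrier, f t = u (fun i => ι (t i))) := by
  classical
  obtain ⟨e, he⟩ := exists_injective_nat U.carrier
  have hfin (m : ℕ) : {x | e x < m}.Finite := (Set.finite_Iio m).preimage he.injOn
  obtain ⟨ι, hι, hfι⟩ := huniv.2 U hc U.younger_refl f hf
  let P (j m : ℕ) : Prop := ∀ t : Fin n → U.carrier, (∀ i, e (t i) < m) → fseq j t = f t
  have key (j : ℕ) : ∃ κ : U.carrier → U.carrier, IsEmb U U κ ∧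
      (∀ t : Fin n → U.carrier, fseq j t = u (fun i => κ (t i))) ∧
      ∀ m ≤ j, P j m → Set.EqOn κ ι {x | e x < m} := by
    obtain ⟨κ, hκ, hfκ⟩ := huniv.2 U hc U.younger_refl (fseq j) (hfseq j)
    by_cases h : ∃ m ≤ j, P j m
    · obtain ⟨m₀, hm₀, hP₀⟩ := h
      obtain ⟨κ', hκ', huκ', hκι⟩ := exists_factorization_eqOn hhomog hκ hι
        (hfin (Nat.findGreatest (P j) j)) (fun t ht => by
          rw [← hfκ, ← hfι]
          exact Nat.findGreatest_spec hm₀ hP₀ t ht)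
      exact ⟨κ', hκ', fun t => (hfκ t).trans (huκ' t).symm, fun m hm hP x hx =>
        hκι (lt_of_lt_of_le hx (Nat.le_findGreatest hm hP))⟩
    · exact ⟨κ, hκ, hfκ, fun m hm hP => absurd ⟨m, hm, hP⟩ h⟩
  choose ιseq hemb hfac heq using key
  refine ⟨ιseq, ι, hemb, hι, hfac, fun x => ?_, hfι⟩
  obtain ⟨N, hN⟩ := hconv.eventually_eqOn
    (Set.Finite.pi' (t := fun _ : Fin n => {y | e y < e x + 1}) fun _ => hfin _)
  exact ⟨max N (e x + 1), fun j hj => heq j (e x + 1) (le_of_max_le_right hj)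
    (fun t ht => hN j (le_of_max_le_left hj) ht) (Nat.lt_succ_self _)⟩
end
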